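/- Let Ω_H = {z ∈ ℂ : Re z ≤ 0} ∪ {∞}, a closed subset of the Riemann sphere ℂ ∪ {∞}, and let H ⊆ ℂ^{n×n} × ℂ^{n×n} be the set of regular n×n pencils (A,B) of index at most 1 whose eigenvalues all belong to Ω_H, where index at most 1 means that the multiplicity of 0 as a root of det(B + X·A) equals n − rank(B). Then the closure of H equals the closure of S(Ω_H,n); in particular, for every pencil (X,Y), the distance from (X,Y) to H equals the distance from (X,Y) to S(Ω_H,n). -/

import Mathlib

open Matrix

/-- The determinant `det(A + X·B)` of the pencil `P = (A,B)`, as a polynomial in `X`. -/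
noncomputable def pencilPoly {n : ℕ}
    (P : Matrix (Fin n) (Fin n) ℂ × Matrix (Fin n) (Fin n) ℂ) : Polynomial ℂ :=
  (P.1.map Polynomial.C + (Polynomial.X : Polynomial ℂ) • P.2.map Polynomial.C).det

/-- `S(Ω,n)`: the set of regular `n×n` pencils all of whose eigenvalues (finite eigenvalues
are the roots of `det(A + X·B)`; `∞` is an eigenvalue iff `det B = 0`) belong to `Ω`,
a subset of the Riemann sphere `ℂ ∪ {∞}`. -/
def SOmega (Ω : Set (OnePoint ℂ)) (n : ℕ) :
    Set (Matrix (Fin n) (Fin n) ℂ × Matrix (Fin n) (Fin n) ℂ) :=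
  {P | pencilPoly P ≠ 0 ∧
    (∀ z : ℂ, (pencilPoly P).IsRoot z → (z : OnePoint ℂ) ∈ Ω) ∧
    (P.2.det = 0 → (OnePoint.infty : OnePoint ℂ) ∈ Ω)}

/-- `S_tri(Ω,n)`: the pencils of `S(Ω,n)` with both coefficients upper triangular. -/
def Stri (Ω : Set (OnePoint ℂ)) (n : ℕ) :
    Set (Matrix (Fin n) (Fin n) ℂ × Matrix (Fin n) (Fin n) ℂ) :=
  {P ∈ SOmega Ω n |
    (∀ i j : Fin n, j < i → P.1 i j = 0) ∧ (∀ i j : Fin n, j < i → P.2 i j = 0)}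

/-- `S(Ω,1)` for `1×1` pencils, identified with pairs `(a,b) ∈ ℂ²`. -/
def SOmega1 (Ω : Set (OnePoint ℂ)) : Set (ℂ × ℂ) :=
  {p | p ≠ (0, 0) ∧ (p.2 ≠ 0 → ((-p.1 / p.2 : ℂ) : OnePoint ℂ) ∈ Ω) ∧
    (p.2 = 0 → (OnePoint.infty : OnePoint ℂ) ∈ Ω)}

/-- The norm `‖(A,B)‖ = (‖A‖_F² + ‖B‖_F²)^{1/2}` of a pencil. -/
noncomputable def pencilNorm {n : ℕ}
    (P : Matrix (Fin n) (Fin n) ℂ × Matrix (Fin n) (Fin n) ℂ) : ℝ :=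
  Real.sqrt (∑ i, ∑ j, (‖P.1 i j‖ ^ 2 + ‖P.2 i j‖ ^ 2))

/-- Euclidean distance on `ℂ²`. -/
noncomputable def distC2 (p q : ℂ × ℂ) : ℝ :=
  Real.sqrt (‖p.1 - q.1‖ ^ 2 + ‖p.2 - q.2‖ ^ 2)

/-- `Ω_H`: the closed left half plane together with `∞`. -/
def OmegaH : Set (OnePoint ℂ) :=
  {z | z = (OnePoint.infty : OnePoint ℂ) ∨ ∃ w : ℂ, w.re ≤ 0 ∧ z = (w : OnePoint ℂ)}

/-- `H`: the set of regular pencils of index at most 1 with all eigenvalues in `Ω_H`;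
index at most 1 means the algebraic multiplicity of the infinite eigenvalue, i.e. the
multiplicity of `0` as a root of `det(B + X·A)`, equals `n − rank B`. -/
def Hset (n : ℕ) : Set (Matrix (Fin n) (Fin n) ℂ × Matrix (Fin n) (Fin n) ℂ) :=
  {P ∈ SOmega OmegaH n | (pencilPoly (P.2, P.1)).rootMultiplicity 0 = n - P.2.rank}

theorem eval_pencilPoly {n : ℕ} (P : Matrix (Fin n) (Fin n) ℂ × Matrix (Fin n) (Fin n) ℂ)
    (z : ℂ) : (pencilPoly P).eval z = (P.1 + z • P.2).det := by
  rw [pencilPoly, ← Polynomial.coe_evalRingHom, RingHom.map_det]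
  congr 1
  ext i j
  simp [mul_comm z]

theorem coe_mem_OmegaH_iff (z : ℂ) : (z : OnePoint ℂ) ∈ OmegaH ↔ z.re ≤ 0 := by
  simp [OmegaH]

/-- A pencil lies in `S(Ω_H,n)` iff it is nonsingular at every point of the open right half
plane. -/
theorem mem_SOmega_OmegaH_iff {n : ℕ}
    (P : Matrix (Fin n) (Fin n) ℂ × Matrix (Fin n) (Fin n) ℂ) :
    P ∈ SOmega OmegaH n ↔ ∀ z : ℂ, 0 < z.re → (P.1 + z • P.2).det ≠ 0 := by
  constructor
  · rintro ⟨-, h, -⟩ z hz h0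
    have := (coe_mem_OmegaH_iff z).1 (h z (by rw [Polynomial.IsRoot, eval_pencilPoly, h0]))
    linarith
  · intro h
    refine ⟨fun h0 => h 1 (by simp) ?_, fun z hz => ?_, fun _ => Or.inl rfl⟩
    · rw [← eval_pencilPoly, h0, Polynomial.eval_zero]
    · rw [coe_mem_OmegaH_iff]
      by_contra! hlt
      exact h z hlt (by rw [← eval_pencilPoly]; exact hz)

/-- The shift `(A, B) ↦ (A, B + tA)` with `t > 0` moves the reciprocals of the eigenvalues to the
left, so it maps `S(Ω_H,n)` into `H`. -/
theorem shift_mem_Hset {n : ℕ} {P : Matrix (Fin n) (Fin n) ℂ × Matrix (Fin n) (Fin n) ℂ}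
    (hP : P ∈ SOmega OmegaH n) {t : ℝ} (ht : 0 < t) :
    (P.1, P.2 + (t : ℂ) • P.1) ∈ Hset n := by
  have h := (mem_SOmega_OmegaH_iff P).1 hP
  have key : ∀ a w : ℂ, a ≠ 0 → 0 < w.re → (a • (P.1 + w • P.2)).det ≠ 0 := by
    intro a w ha hw
    rw [det_smul]
    exact mul_ne_zero (pow_ne_zero _ ha) (h w hw)
  have htC : (t : ℂ) ≠ 0 := by exact_mod_cast ht.ne'
  have hdet : (P.2 + (t : ℂ) • P.1).det ≠ 0 := by
    have := key t ((t⁻¹ : ℝ) : ℂ) htC (by simpa using ht)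
    rwa [smul_add, smul_smul, Complex.ofReal_inv, mul_inv_cancel₀ htC, one_smul, add_comm] at this
  refine ⟨(mem_SOmega_OmegaH_iff _).2 fun z hz => ?_, ?_⟩
  · have hz0 : z ≠ 0 := by
      rintro rfl
      simp at hz
    have ha : 1 + z * t ≠ 0 := by
      intro h0
      have := congrArg Complex.re h0
      simp at this
      nlinarith
    have hw : 0 < (z / (1 + z * t)).re := by
      have hinv : z / (1 + z * t) = (z⁻¹ + t)⁻¹ := by
        rw [← inv_div, add_div, mul_div_cancel_left₀ _ hz0, one_div]
      have hre : 0 < (z⁻¹ + t).re := by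
        rw [Complex.add_re, Complex.inv_re, Complex.ofReal_re]
        have := Complex.normSq_pos.2 hz0
        positivity
      rw [hinv, Complex.inv_re]
      refine div_pos hre (Complex.normSq_pos.2 fun h0 => ?_)
      simp [h0] at hre
    have := key _ _ ha hw
    rw [smul_add, smul_smul, mul_div_cancel₀ _ ha] at this
    convert this using 2
    simp only [smul_add, smul_smul, add_smul, one_smul]
    abel
  · have hrank : (P.2 + (t : ℂ) • P.1).rank = n := by
      rw [rank_of_isUnit _ ((isUnit_iff_isUnit_det _).2 hdet.isUnit), Fintype.card_fin]
    rw [hrank, Nat.sub_self]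
    refine Polynomial.rootMultiplicity_eq_zero ?_
    rw [Polynomial.IsRoot, eval_pencilPoly]
    simpa using hdet

theorem continuous_pencilNorm {n : ℕ} :
    Continuous (pencilNorm : Matrix (Fin n) (Fin n) ℂ × Matrix (Fin n) (Fin n) ℂ → ℝ) := by
  unfold pencilNorm
  refine Real.continuous_sqrt.comp (continuous_finsetSum _ fun i _ =>
    continuous_finsetSum _ fun j _ => ?_)
  exact ((continuous_fst.matrix_elem i j).norm.pow 2).add
    ((continuous_snd.matrix_elem i j).norm.pow 2)

theorem tendsto_shift {n : ℕ} (P : Matrix (Fin n) (Fin n) ℂ × Matrix (Fin n) (Fin n) ℂ) :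
    Filter.Tendsto (fun t : ℝ => (P.1, P.2 + (t : ℂ) • P.1)) (nhdsWithin 0 (Set.Ioi 0))
      (nhds P) := by
  have hc : Continuous fun t : ℝ => (P.1, P.2 + (t : ℂ) • P.1) := by fun_prop
  simpa using (hc.tendsto 0).mono_left nhdsWithin_le_nhds

/-- the closure of `H` equals the closure of `S(Ω_H,n)`; in particular the
distance from any pencil to `H` equals its distance to `S(Ω_H,n)`. -/
theorem closure_Hset_eq_closure_SOmega (n : ℕ) :
    closure (Hset n) = closure (SOmega OmegaH n) ∧
    ∀ X : Matrix (Fin n) (Fin n) ℂ × Matrix (Fin n) (Fin n) ℂ,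
      sInf {r : ℝ | ∃ P ∈ Hset n, r = pencilNorm (X - P)} =
      sInf {r : ℝ | ∃ P ∈ SOmega OmegaH n, r = pencilNorm (X - P)} := by
  have hsub : Hset n ⊆ SOmega OmegaH n := fun P hP => hP.1
  have hev : ∀ P ∈ SOmega OmegaH n, ∀ᶠ t : ℝ in nhdsWithin 0 (Set.Ioi 0),
      (P.1, P.2 + (t : ℂ) • P.1) ∈ Hset n := fun P hP => by
    filter_upwards [self_mem_nhdsWithin] with t ht using shift_mem_Hset hP ht
  refine ⟨(closure_mono hsub).antisymm (closure_minimal (fun P hP =>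
    mem_closure_of_tendsto (tendsto_shift P) (hev P hP)) isClosed_closure), fun X => ?_⟩
  have hne : (1, 1) ∈ SOmega OmegaH n := by
    refine (mem_SOmega_OmegaH_iff _).2 fun z hz => ?_
    have h1 : (1 : Matrix (Fin n) (Fin n) ℂ) + z • 1 = (1 + z) • 1 := by rw [add_smul, one_smul]
    rw [h1, det_smul, det_one, mul_one]
    refine pow_ne_zero _ fun h0 => ?_
    have := congrArg Complex.re h0
    simp at this
    linarith
  have hbdd : ∀ s : Set (Matrix (Fin n) (Fin n) ℂ × Matrix (Fin n) (Fin n) ℂ),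
      BddBelow {r : ℝ | ∃ P ∈ s, r = pencilNorm (X - P)} := fun s =>
    ⟨0, by rintro _ ⟨P, -, rfl⟩; exact Real.sqrt_nonneg _⟩
  apply le_antisymm
  · refine le_csInf ⟨_, _, hne, rfl⟩ ?_
    rintro _ ⟨P, hP, rfl⟩
    refine ge_of_tendsto ((continuous_pencilNorm.tendsto _).comp
      (tendsto_const_nhds.sub (tendsto_shift P))) ?_
    filter_upwards [hev P hP] with t ht using csInf_le (hbdd _) ⟨_, ht, rfl⟩
  · refine csInf_le_csInf (hbdd _) ⟨_, _, shift_mem_Hset hne one_pos, rfl⟩ ?_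
    rintro _ ⟨P, hP, rfl⟩
    exact ⟨P, hsub hP, rfl⟩
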